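/- arXiv:1803.06101 — 3 statements merged into one kernel-verified Lean document; each statement's English description precedes it below -/
import Mathlib

section
/- Let γ_1 ≥ γ_2 ≥ ⋯ be a nonincreasing sequence of positive reals defining product weights γ_u = ∏_{j∈u} γ_j, and suppose ∑_{j≥1} j·γ_j < ∞. Then the weighted star discrepancy of the Halton sequence achieves strong polynomial tractability with ε-exponent 1: for every β > 1 there exists a constant C > 0 such that for every dimension d ≥ 1 and every ε ∈ (0,1) there is an integer N ≤ C·ε^{−β} with D*_{N,γ}(H_{d,N}) ≤ ε. -/
open Finset Real

noncomputable section

/-- Radical inverse function in base `b`: if `n = ∑ nᵢ bⁱ` then `radInv b n = ∑ nᵢ b^{-i-1}`. -/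
def radInv (b n : ℕ) : ℝ := ∑' i : ℕ, (((n / b ^ i) % b : ℕ) : ℝ) / (b : ℝ) ^ (i + 1)

/-- `n`-th point of the `d`-dimensional Halton sequence; coordinate `j` (0-based)
uses the `(j+1)`-st prime (`Nat.nth Nat.Prime 0 = 2`). -/
def halton (d n : ℕ) : Fin d → ℝ := fun j => radInv (Nat.nth Nat.Prime j) n

open scoped Classical in
/-- Star discrepancy of the point set `P` of `N` points with coordinates indexed by `ι`:
`D*_N(P) = sup_{α ∈ [0,1]^ι} |#{n : P n ∈ [0,α)}/N − ∏ᵢ αᵢ|`. -/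
def starDisc {ι : Type} [Fintype ι] (N : ℕ) (P : Fin N → ι → ℝ) : ℝ :=
  sSup {t : ℝ | ∃ α : ι → ℝ, (∀ i, 0 ≤ α i ∧ α i ≤ 1) ∧
    t = |((Finset.univ.filter fun n : Fin N => ∀ i, 0 ≤ P n i ∧ P n i < α i).card : ℝ) / N
          - ∏ i, α i|}

/-- Star discrepancy of the projection of the first `N` points of the `d`-dimensional
Halton sequence onto the coordinates in `u`. -/
def haltonProjStarDisc (d N : ℕ) (u : Finset (Fin d)) : ℝ :=
  starDisc N fun n (i : u) => halton d n i.1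

/-- Weighted star discrepancy, for product weights built from `γ : ℕ → ℝ` (1-based:
coordinate `j : Fin d` carries weight `γ (j+1)`), of the first `N` points of the
`d`-dimensional Halton sequence:
`max_{∅ ≠ u ⊆ [d]} (∏_{j ∈ u} γ_j) · D*_N(H_{d,N}(u))`. -/
def wHaltonStarDisc (γ : ℕ → ℝ) (d N : ℕ) : ℝ :=
  sSup {t : ℝ | ∃ u : Finset (Fin d), u.Nonempty ∧
    t = (∏ j ∈ u, γ (j.1 + 1)) * haltonProjStarDisc d N u}

theorem modEq_mul_add_iff {p t : ℕ} (ht : t < p) (n r k : ℕ) :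
    n ≡ p * r + t [MOD p ^ (k + 1)] ↔ n % p = t ∧ n / p ≡ r [MOD p ^ k] := by
  have hp : 0 < p := by omega
  constructor
  · intro h
    have h1 : n % p = t := by
      have := h.of_dvd (dvd_pow_self p (Nat.succ_ne_zero k))
      simpa [Nat.ModEq, Nat.mod_eq_of_lt ht, Nat.add_mod] using this
    refine ⟨h1, ?_⟩
    rw [← Nat.div_add_mod n p, h1, pow_succ'] at h
    exact Nat.ModEq.mul_left_cancel' hp.ne' (Nat.ModEq.add_right_cancel' t h)
  · rintro ⟨h1, h2⟩
    rw [← Nat.div_add_mod n p, h1, pow_succ']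
    exact (Nat.ModEq.mul_left' p h2).add_right t

/-- `IsResidueSum p f δ K` says that `f` is a sum of `K` indicator functions of residue classes
modulo powers of `p`, and that `δ` is the sum of the densities of these classes. -/
inductive IsResidueSum (p : ℕ) : (ℕ → ℝ) → ℝ → ℕ → Prop
  | zero : IsResidueSum p (fun _ => 0) 0 0
  | add {f : ℕ → ℝ} {δ : ℝ} {K : ℕ} (k r : ℕ) (h : IsResidueSum p f δ K) :
      IsResidueSum p (fun n => f n + if n ≡ r [MOD p ^ k] then 1 else 0)
        (δ + ((p : ℝ) ^ k)⁻¹) (K + 1)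

namespace IsResidueSum

variable {p : ℕ} {f : ℕ → ℝ} {δ : ℝ} {K : ℕ}

theorem one (p : ℕ) : IsResidueSum p (fun _ => 1) 1 1 := by
  convert IsResidueSum.add 0 0 (IsResidueSum.zero (p := p)) using 1 <;> simp [Nat.modEq_one]

/-- Prepending a digit `t` to the digit expansions described by `f`. -/
theorem cons_digit (h : IsResidueSum p f δ K) {t : ℕ} (ht : t < p) :
    IsResidueSum p (fun n => if n % p = t then f (n / p) else 0) (δ / p) K := by
  induction h with
  | zero => simpa using IsResidueSum.zero (p := p)
  | @add f δ K k r h ih =>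
    convert IsResidueSum.add (k + 1) (p * r + t) ih using 1
    · funext n
      simp only [modEq_mul_add_iff ht]
      by_cases h1 : n % p = t <;> simp [h1]
    · rw [add_div, pow_succ, mul_inv, div_eq_mul_inv (_ ⁻¹)]

theorem add_mod_lt (h : IsResidueSum p f δ K) (t : ℕ) (ht : t ≤ p) :
    IsResidueSum p (fun n => f n + if n % p < t then 1 else 0) (δ + t / p) (K + t) := by
  induction t with
  | zero => simpa using h
  | succ t ih =>
    convert IsResidueSum.add 1 t (ih (by omega)) using 1
    · funext n
      have : n ≡ t [MOD p ^ 1] ↔ n % p = t := by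
        rw [pow_one, Nat.ModEq, Nat.mod_eq_of_lt (show t < p by omega)]
      simp only [this]
      rcases lt_trichotomy (n % p) t with h1 | h1 | h1
      · simp [h1, h1.ne, Nat.lt_succ_of_lt h1]
      · simp [h1]
      · simp [h1.ne', h1.not_gt, show ¬ n % p < t + 1 by omega]
    · push_cast
      ring
    · omega

theorem discrepancy_mul (h : IsResidueSum p f δ K) (N : ℕ) (g : ℕ → ℝ) (η B : ℝ) (Q R : ℕ)
    (hQ : Q.Coprime p)
    (hg : ∀ k R' : ℕ, |∑ n ∈ range N, (if n ≡ R' [MOD Q * p ^ k] then g n else 0)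
      - N / ((Q * p ^ k : ℕ) : ℝ) * η| ≤ B) :
    |∑ n ∈ range N, (if n ≡ R [MOD Q] then f n * g n else 0) - N / (Q : ℝ) * (δ * η)|
      ≤ K * B := by
  induction h with
  | zero => simp
  | @add f δ K k r h ih =>
    have hco : Q.Coprime (p ^ k) := hQ.pow_right k
    obtain ⟨R', h1, h2⟩ := Nat.chineseRemainder hco R r
    have key : ∀ n, (n ≡ R' [MOD Q * p ^ k]) ↔ n ≡ R [MOD Q] ∧ n ≡ r [MOD p ^ k] := fun n => by
      rw [← Nat.modEq_and_modEq_iff_modEq_mul hco]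
      exact ⟨fun ⟨a, b⟩ => ⟨a.trans h1, b.trans h2⟩,
        fun ⟨a, b⟩ => ⟨a.trans h1.symm, b.trans h2.symm⟩⟩
    have hs : ∑ n ∈ range N, (if n ≡ R [MOD Q] then
          (f n + if n ≡ r [MOD p ^ k] then 1 else 0) * g n else 0)
        = ∑ n ∈ range N, (if n ≡ R [MOD Q] then f n * g n else 0)
          + ∑ n ∈ range N, (if n ≡ R' [MOD Q * p ^ k] then g n else 0) := by
      rw [← sum_add_distrib]
      refine sum_congr rfl fun n _ => ?_
      simp only [key]
      by_cases a : n ≡ R [MOD Q] <;> by_cases b : n ≡ r [MOD p ^ k] <;> simp [a, b, add_mul]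
    have hd : N / (Q : ℝ) * ((δ + ((p : ℝ) ^ k)⁻¹) * η)
        = N / (Q : ℝ) * (δ * η) + N / ((Q * p ^ k : ℕ) : ℝ) * η := by
      push_cast
      rw [div_mul_eq_div_div, div_eq_mul_inv (_ / _) ((p : ℝ) ^ k)]
      ring
    rw [hs, hd, add_sub_add_comm]
    refine (abs_add_le _ _).trans ?_
    rw [Nat.cast_succ, add_one_mul]
    exact add_le_add ih (hg k R')

end IsResidueSum

theorem abs_card_modEq_sub_le (N Q R : ℕ) (hQ : 0 < Q) :
    |∑ n ∈ range N, (if n ≡ R [MOD Q] then (1 : ℝ) else 0) - N / (Q : ℝ)| ≤ 1 := by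
  have h := Nat.count_modEq_card N hQ R
  rw [Nat.count_eq_card_filter_range] at h
  rw [sum_boole, h]
  have hQ' : (0 : ℝ) < Q := by exact_mod_cast hQ
  have e : (N : ℝ) / Q = (N / Q : ℕ) + ((N % Q : ℕ) : ℝ) / Q := by
    rw [div_eq_iff hQ'.ne', add_mul, div_mul_cancel₀ _ hQ'.ne']
    exact_mod_cast (Nat.div_add_mod' N Q).symm
  have l1 : ((N % Q : ℕ) : ℝ) / Q ≤ 1 := by
    rw [div_le_one hQ']
    exact_mod_cast (Nat.mod_lt N hQ).le
  have l0 : 0 ≤ ((N % Q : ℕ) : ℝ) / Q := by positivity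
  rw [e, abs_le]
  push_cast
  split_ifs <;> constructor <;> norm_num <;> linarith

theorem abs_sum_prod_residueSum_sub_le {ι : Type*} (N : ℕ) (q : ι → ℕ) (f : ι → ℕ → ℝ) (δ : ι → ℝ)
    (K : ι → ℕ) (u : Finset ι) (hq : ∀ i ∈ u, 0 < q i)
    (hco : Set.Pairwise (u : Set ι) fun i j => (q i).Coprime (q j))
    (h : ∀ i ∈ u, IsResidueSum (q i) (f i) (δ i) (K i)) (Q R : ℕ) (hQ : 0 < Q)
    (hQu : ∀ i ∈ u, Q.Coprime (q i)) :
    |∑ n ∈ range N, (if n ≡ R [MOD Q] then ∏ i ∈ u, f i n else 0) - N / (Q : ℝ) * ∏ i ∈ u, δ i|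
      ≤ ∏ i ∈ u, (K i : ℝ) := by
  classical
  induction u using Finset.induction_on generalizing Q R with
  | empty => simpa using abs_card_modEq_sub_le N Q R hQ
  | insert i u hi ih =>
    simp only [prod_insert hi]
    refine (h i (mem_insert_self i u)).discrepancy_mul N _ _ _ Q R (hQu i (mem_insert_self i u))
      fun k R' => ?_
    refine ih (fun j hj => hq j (mem_insert_of_mem hj)) (hco.mono (by simp))
      (fun j hj => h j (mem_insert_of_mem hj)) _ _
      (Nat.mul_pos hQ (pow_pos (hq i (mem_insert_self i u)) k)) fun j hj => ?_
    refine Nat.Coprime.mul_left (hQu j (mem_insert_of_mem hj)) (Nat.Coprime.pow_left k ?_)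
    exact hco (by simp) (by simp [hj]) (by rintro rfl; exact hi hj)

theorem radInv_eq_div {p : ℕ} (hp : 2 ≤ p) (n : ℕ) :
    radInv p n = ((n % p : ℕ) + radInv p (n / p)) / p := by
  have hs : Summable fun i : ℕ => (((n / p ^ i) % p : ℕ) : ℝ) / (p : ℝ) ^ (i + 1) := by
    refine summable_of_ne_finset_zero (s := range n) fun i hi => ?_
    have : n < p ^ i := lt_of_le_of_lt (by simpa using hi) (Nat.lt_pow_self (by omega))
    simp [Nat.div_eq_of_lt this]
  unfold radInv
  rw [hs.tsum_eq_zero_add, add_div, ← tsum_div_const]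
  congr 1
  · simp
  · refine tsum_congr fun i => ?_
    rw [pow_succ' p i, ← Nat.div_div_eq_div_mul, div_div, ← pow_succ]

theorem radInv_nonneg (p n : ℕ) : 0 ≤ radInv p n := tsum_nonneg fun _ => by positivity

theorem radInv_lt_one {p : ℕ} (hp : 2 ≤ p) (n : ℕ) : radInv p n < 1 := by
  have hp' : (0 : ℝ) < p := by positivity
  induction n using Nat.strong_induction_on with
  | _ n ih =>
    rcases Nat.eq_zero_or_pos n with rfl | hn
    · simp [radInv]
    · rw [radInv_eq_div hp, div_lt_one hp']
      have h1 := ih (n / p) (Nat.div_lt_self hn hp)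
      have h2 : ((n % p : ℕ) : ℝ) + 1 ≤ p := by exact_mod_cast Nat.mod_lt n (by omega)
      linarith

/-- The indicator of `{n | radInv p n < α}` lies between two sums of `m * (p - 1) + 1` residue
classes whose densities differ by at most `p ^ (-m)`. -/
theorem exists_residueSum_bracket_of_lt_one {p : ℕ} (hp : 2 ≤ p) (m : ℕ) (α : ℝ) (h0 : 0 ≤ α)
    (h1 : α < 1) :
    ∃ (f g : ℕ → ℝ) (δ η : ℝ) (K L : ℕ), IsResidueSum p f δ K ∧ IsResidueSum p g η L ∧
      (∀ n, 0 ≤ f n) ∧ (∀ n, f n ≤ if radInv p n < α then 1 else 0) ∧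
      (∀ n, (if radInv p n < α then 1 else 0) ≤ g n) ∧ 0 ≤ δ ∧ δ ≤ α ∧ α ≤ η ∧ η ≤ 1 ∧
      η - δ ≤ ((p : ℝ) ^ m)⁻¹ ∧ K ≤ m * (p - 1) + 1 ∧ L ≤ m * (p - 1) + 1 := by
  have hp' : (0 : ℝ) < p := by positivity
  induction m generalizing α with
  | zero =>
    refine ⟨_, _, _, _, _, _, IsResidueSum.zero, IsResidueSum.one p, fun _ => le_rfl, ?_, ?_,
      le_rfl, h0, h1.le, le_rfl, by simp, by simp, by simp⟩ <;> intro n <;> split_ifs <;> norm_num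
  | succ m ih =>
    set t := ⌊p * α⌋₊ with ht
    have hα : 0 ≤ p * α := by positivity
    have t0 : (t : ℝ) ≤ p * α := Nat.floor_le hα
    have t1 : p * α < t + 1 := Nat.lt_floor_add_one _
    have tp : t < p := by
      rw [ht, Nat.floor_lt hα]
      nlinarith
    have tp' : (t : ℝ) + 1 ≤ p := by exact_mod_cast tp
    obtain ⟨f, g, δ, η, K, L, hf, hg, f0, f1, g1, d0, d1, e0, e1, de, hK, hL⟩ :=
      ih (p * α - t) (by linarith) (by linarith)
    have hind : ∀ n, (if radInv p n < α then (1 : ℝ) else 0)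
        = (if n % p = t then (if radInv p (n / p) < p * α - t then 1 else 0) else 0)
          + if n % p < t then 1 else 0 := fun n => by
      have e : radInv p n < α ↔ ((n % p : ℕ) : ℝ) + radInv p (n / p) < p * α := by
        rw [radInv_eq_div hp, div_lt_iff₀ hp', mul_comm α]
      have r0 := radInv_nonneg p (n / p)
      have r1 := radInv_lt_one hp (n / p)
      rcases lt_trichotomy (n % p) t with h | h | h
      · have : ((n % p : ℕ) : ℝ) + 1 ≤ t := by exact_mod_cast h
        rw [if_pos (e.2 (by linarith)), if_neg h.ne, if_pos h, zero_add]
      · simp only [e, h, lt_irrefl, if_true, if_false, add_zero, lt_sub_iff_add_lt']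
      · have : (t : ℝ) + 1 ≤ (n % p : ℕ) := by exact_mod_cast h
        rw [if_neg (fun h' => by linarith [e.1 h']), if_neg h.ne', if_neg h.not_gt, zero_add]
    have hm : (m + 1) * (p - 1) + 1 = m * (p - 1) + 1 + (p - 1) := by ring
    refine ⟨_, _, _, _, _, _, (hf.cons_digit tp).add_mod_lt t tp.le,
      (hg.cons_digit tp).add_mod_lt t tp.le, fun n => ?_, fun n => ?_, fun n => ?_,
      by positivity, ?_, ?_, ?_, ?_, by omega, by omega⟩
    · have := f0 (n / p)
      positivity
    · rw [hind n]
      have := f1 (n / p)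
      gcongr
      split_ifs at this ⊢ <;> linarith
    · rw [hind n]
      have := g1 (n / p)
      gcongr
      split_ifs at this ⊢ <;> linarith
    · rw [← add_div, div_le_iff₀ hp']
      linarith
    · rw [← add_div, le_div_iff₀ hp']
      linarith
    · rw [← add_div, div_le_one hp']
      linarith
    · rw [pow_succ, mul_inv, ← div_eq_mul_inv, add_sub_add_right_eq_sub, ← sub_div]
      gcongr

theorem exists_residueSum_bracket {p : ℕ} (hp : 2 ≤ p) (m : ℕ) (α : ℝ) (h0 : 0 ≤ α)
    (h1 : α ≤ 1) :
    ∃ (f g : ℕ → ℝ) (δ η : ℝ) (K L : ℕ), IsResidueSum p f δ K ∧ IsResidueSum p g η L ∧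
      (∀ n, 0 ≤ f n) ∧ (∀ n, f n ≤ if radInv p n < α then 1 else 0) ∧
      (∀ n, (if radInv p n < α then 1 else 0) ≤ g n) ∧ 0 ≤ δ ∧ δ ≤ α ∧ α ≤ η ∧ η ≤ 1 ∧
      η - δ ≤ ((p : ℝ) ^ m)⁻¹ ∧ K ≤ m * (p - 1) + 1 ∧ L ≤ m * (p - 1) + 1 := by
  rcases h1.lt_or_eq with h | rfl
  · exact exists_residueSum_bracket_of_lt_one hp m α h0 h
  · refine ⟨_, _, _, _, _, _, IsResidueSum.one p, IsResidueSum.one p, fun _ => zero_le_one, ?_, ?_,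
      zero_le_one, le_rfl, le_rfl, le_rfl, by simp, by simp, by simp⟩ <;>
      simp [radInv_lt_one hp]

theorem prod_sub_prod_le_sum_sub {ι : Type*} (s : Finset ι) {a b : ι → ℝ} (ha : ∀ i ∈ s, 0 ≤ a i)
    (hab : ∀ i ∈ s, a i ≤ b i) (hb : ∀ i ∈ s, b i ≤ 1) :
    ∏ i ∈ s, b i - ∏ i ∈ s, a i ≤ ∑ i ∈ s, (b i - a i) := by
  classical
  induction s using Finset.induction_on with
  | empty => simp
  | insert i s hi ih =>
    simp only [forall_mem_insert] at ha hab hb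
    rw [prod_insert hi, prod_insert hi, sum_insert hi]
    have h1 := ih ha.2 hab.2 hb.2
    have h2 : ∏ j ∈ s, b j ≤ 1 := prod_le_one (fun j hj => (ha.2 j hj).trans (hab.2 j hj)) hb.2
    have h3 : ∏ j ∈ s, a j ≤ ∏ j ∈ s, b j := prod_le_prod ha.2 hab.2
    nlinarith [hab.1, ha.1, hb.1]

/-- The discrepancy bound for Halton-type point sets in pairwise coprime bases. -/
theorem mul_starDisc_radInv_le {ι : Type} [Fintype ι] (q : ι → ℕ) (hq : ∀ i, 2 ≤ q i)
    (hco : Pairwise fun i j => (q i).Coprime (q j)) {N : ℕ} (hN : 2 ≤ N) :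
    N * starDisc N (fun (n : Fin N) i => radInv (q i) n)
      ≤ 2 * ∏ i, ((q i * Nat.clog (q i) N : ℕ) : ℝ) := by
  have hN0 : (0 : ℝ) < N := by positivity
  set F : ℝ := ∏ i, ((q i * Nat.clog (q i) N : ℕ) : ℝ) with hF
  have hF0 : 0 ≤ F := by positivity
  rw [mul_comm, ← le_div_iff₀ hN0]
  refine Real.sSup_le ?_ (by positivity)
  rintro _ ⟨α, hα, rfl⟩
  choose f g δ η K L hf hg f0 f1 g1 d0 d1 e0 e1 de hK hL using fun i =>
    exists_residueSum_bracket (hq i) (Nat.clog (q i) N) (α i) (hα i).1 (hα i).2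
  have hm : ∀ i, 1 ≤ Nat.clog (q i) N := fun i => Nat.clog_pos (hq i) hN
  have hKm : ∀ i, Nat.clog (q i) N * (q i - 1) + 1 ≤ q i * Nat.clog (q i) N := fun i => by
    obtain ⟨r, hr⟩ : ∃ r, q i = r + 1 := ⟨q i - 1, by have := hq i; omega⟩
    have := hm i
    rw [hr] at this ⊢
    simp only [Nat.add_sub_cancel]
    nlinarith
  have hKF : ∏ i, (K i : ℝ) ≤ F := prod_le_prod (fun _ _ => by positivity) fun i _ => by
    exact_mod_cast (hK i).trans (hKm i)
  have hLF : ∏ i, (L i : ℝ) ≤ F := prod_le_prod (fun _ _ => by positivity) fun i _ => by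
    exact_mod_cast (hL i).trans (hKm i)
  have hdF : N * (∏ i, η i - ∏ i, δ i) ≤ F := by
    have h1 := prod_sub_prod_le_sum_sub univ (fun i _ => d0 i)
      (fun i _ => (d1 i).trans (e0 i)) (fun i _ => e1 i)
    have h2 : ∑ i, (η i - δ i) ≤ ∑ _i : ι, (N : ℝ)⁻¹ := sum_le_sum fun i _ =>
      (de i).trans (inv_anti₀ hN0 (by exact_mod_cast Nat.le_pow_clog (hq i) N))
    have h3 : (Fintype.card ι : ℝ) ≤ F := by
      have h4 : (Fintype.card ι : ℝ) ≤ 2 ^ Fintype.card ι := by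
        exact_mod_cast Nat.lt_two_pow_self.le
      have h5 : ∏ _i : ι, (2 : ℝ) ≤ F := prod_le_prod (fun _ _ => by positivity) fun i _ => by
        exact_mod_cast (hq i).trans (Nat.le_mul_of_pos_right _ (hm i))
      simp only [prod_const, card_univ] at h5
      exact h4.trans h5
    rw [sum_const, card_univ, nsmul_eq_mul] at h2
    calc N * (∏ i, η i - ∏ i, δ i) ≤ N * (Fintype.card ι * (N : ℝ)⁻¹) := by
          gcongr
          exact h1.trans h2
      _ = Fintype.card ι := by field_simp
      _ ≤ F := h3
  have hlow : ∏ i, δ i ≤ ∏ i, α i := prod_le_prod (fun i _ => d0 i) fun i _ => d1 i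
  have hupp : ∏ i, α i ≤ ∏ i, η i := prod_le_prod (fun i _ => (hα i).1) fun i _ => e0 i
  have hsf := abs_sum_prod_residueSum_sub_le N q f δ K univ (fun i _ => by have := hq i; omega)
    (fun i _ j _ h => hco h) (fun i _ => hf i) 1 0 one_pos (fun i _ => Nat.coprime_one_left _)
  have hsg := abs_sum_prod_residueSum_sub_le N q g η L univ (fun i _ => by have := hq i; omega)
    (fun i _ j _ h => hco h) (fun i _ => hg i) 1 0 one_pos (fun i _ => Nat.coprime_one_left _)
  simp only [Nat.modEq_one, if_true, Nat.cast_one, div_one] at hsf hsg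
  classical
  have hcard : ((univ.filter fun n : Fin N =>
      ∀ i, 0 ≤ radInv (q i) n ∧ radInv (q i) n < α i).card : ℝ)
      = ∑ n ∈ range N, ∏ i, if radInv (q i) n < α i then (1 : ℝ) else 0 := by
    rw [← Fin.sum_univ_eq_sum_range
      (fun n => ∏ i, if radInv (q i) n < α i then (1 : ℝ) else 0) N]
    simp [prod_boole, radInv_nonneg]
  have hcf : ∑ n ∈ range N, ∏ i, f i n
      ≤ ∑ n ∈ range N, ∏ i, if radInv (q i) n < α i then (1 : ℝ) else 0 :=
    sum_le_sum fun n _ => prod_le_prod (fun i _ => f0 i n) fun i _ => f1 i n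
  have hcg : ∑ n ∈ range N, ∏ i, (if radInv (q i) n < α i then (1 : ℝ) else 0)
      ≤ ∑ n ∈ range N, ∏ i, g i n :=
    sum_le_sum fun n _ => prod_le_prod (fun i _ => by positivity) fun i _ => g1 i n
  rw [← hcard] at hcf hcg
  rw [le_div_iff₀ hN0, ← abs_of_pos hN0, ← abs_mul, abs_of_pos hN0, sub_mul,
    div_mul_cancel₀ _ hN0.ne']
  rw [abs_le] at hsf hsg
  have a1 := mul_le_mul_of_nonneg_left hlow hN0.le
  have a2 := mul_le_mul_of_nonneg_left hupp hN0.le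
  rw [abs_le]
  constructor
  · refine le_trans ?_ (sub_le_sub_right (le_of_le_of_eq hcf ?_) _)
    · linarith
    · congr!
  · refine le_trans (sub_le_sub_right (le_of_eq_of_le ?_ hcg) _) ?_
    · congr!
    · linarith

theorem starDisc_le_one {ι : Type} [Fintype ι] (N : ℕ) (P : Fin N → ι → ℝ) :
    starDisc N P ≤ 1 := by
  refine Real.sSup_le ?_ zero_le_one
  rintro _ ⟨α, hα, rfl⟩
  have h1 : ∏ i, α i ≤ 1 := prod_le_one (fun i _ => (hα i).1) fun i _ => (hα i).2
  have h0 : 0 ≤ ∏ i, α i := prod_nonneg fun i _ => (hα i).1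
  refine abs_sub_le_of_nonneg_of_le (by positivity) (div_le_one_of_le₀ ?_ (by positivity)) h0 h1
  exact_mod_cast (card_filter_le _ _).trans (by simp)

theorem le_ten_mul_primeCounting_mul_log {n : ℕ} (hn : 2 ≤ n) :
    (n : ℝ) ≤ 10 * (Nat.primeCounting n * Real.log n) := by
  have hn' : (2 : ℝ) ≤ n := by exact_mod_cast hn
  have hlog : 0 < Real.log n := Real.log_pos (by linarith)
  have h := Chebyshev.pi_ge n
  rw [div_le_iff₀ hlog] at h
  have h1 : Real.log (n + 1) = 2 * Real.log 2 + Real.log ((n + 1) / 4) := by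
    rw [Real.log_div (by positivity) (by norm_num), show (4 : ℝ) = 2 ^ 2 by norm_num,
      Real.log_pow]
    push_cast
    ring
  have h2 : Real.log (((n : ℝ) + 1) / 4) ≤ (n + 1) / 4 - 1 :=
    Real.log_le_sub_one_of_pos (by positivity)
  have h3 := Real.log_two_gt_d9
  have h4 := Real.log_two_lt_d9
  nlinarith

theorem natCast_clog_le {b n : ℕ} (hb : 2 ≤ b) (hbn : b ≤ n) :
    (Nat.clog b n : ℝ) * Real.log b ≤ 2 * Real.log n := by
  have hm : 1 ≤ Nat.clog b n := Nat.clog_pos hb (by omega)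
  have h := Nat.pow_pred_clog_lt_self (b := b) (x := n) hb (by omega)
  have hb0 : (0 : ℝ) < b := by positivity
  have h1 : Real.log ((b : ℝ) ^ (Nat.clog b n).pred) ≤ Real.log n :=
    Real.log_le_log (by positivity) (by exact_mod_cast h.le)
  have h2 : Real.log b ≤ Real.log n := Real.log_le_log hb0 (by exact_mod_cast hbn)
  have h3 : ((Nat.clog b n).pred : ℝ) = Nat.clog b n - 1 := by
    rw [Nat.pred_eq_sub_one, Nat.cast_sub hm, Nat.cast_one]
  rw [Real.log_pow, h3] at h1
  linarith

theorem primeCounting_nth_prime (i : ℕ) : Nat.primeCounting (Nat.nth Nat.Prime i) = i + 1 := by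
  rw [Nat.primeCounting, Nat.primeCounting', Nat.count_succ, if_pos (Nat.prime_nth_prime i),
    Nat.count_nth_of_infinite Nat.infinite_setOfPred_prime]

theorem nth_prime_mul_clog_le {i N : ℕ} (h : Nat.nth Nat.Prime i ≤ N) :
    ((Nat.nth Nat.Prime i * Nat.clog (Nat.nth Nat.Prime i) N : ℕ) : ℝ)
      ≤ 20 * ((i + 1) * Real.log N) := by
  set p := Nat.nth Nat.Prime i with hp
  have hp2 : 2 ≤ p := (Nat.prime_nth_prime i).two_le
  have h1 := le_ten_mul_primeCounting_mul_log hp2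
  have h2 := natCast_clog_le hp2 h
  rw [hp, primeCounting_nth_prime, ← hp] at h1
  push_cast at h1 ⊢
  calc (p : ℝ) * Nat.clog p N ≤ 10 * ((i + 1) * Real.log p) * Nat.clog p N := by gcongr
    _ = 10 * (i + 1) * (Nat.clog p N * Real.log p) := by ring
    _ ≤ 10 * (i + 1) * (2 * Real.log N) := by gcongr
    _ = 20 * ((i + 1) * Real.log N) := by ring

theorem natCast_le_of_lt_nth_prime {i N : ℕ} (hN : 2 ≤ N) (h : N < Nat.nth Nat.Prime i) :
    (N : ℝ) ≤ 20 * ((i + 1) * Real.log N) := by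
  have h1 := le_ten_mul_primeCounting_mul_log hN
  have h2 : Nat.primeCounting N ≤ i + 1 :=
    (Nat.monotone_primeCounting h.le).trans (primeCounting_nth_prime i).le
  have h3 : (Nat.primeCounting N : ℝ) ≤ i + 1 := by exact_mod_cast h2
  have h4 : 0 ≤ Real.log N := Real.log_natCast_nonneg N
  have h5 := mul_le_mul_of_nonneg_right h3 h4
  have h6 : 0 ≤ ((i : ℝ) + 1) * Real.log N := by positivity
  linarith

theorem mul_haltonProjStarDisc_le (d : ℕ) {N : ℕ} (hN : 2 ≤ N) (u : Finset (Fin d)) :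
    N * haltonProjStarDisc d N u ≤ 2 * ∏ j ∈ u, 20 * (((j : ℕ) + 1) * Real.log N) := by
  by_cases hu : ∀ j ∈ u, Nat.nth Nat.Prime j ≤ N
  · have h := mul_starDisc_radInv_le (ι := u) (fun i => Nat.nth Nat.Prime (i.1 : ℕ))
      (fun i => (Nat.prime_nth_prime _).two_le) (fun i j hij => by
        refine (Nat.coprime_primes (Nat.prime_nth_prime _) (Nat.prime_nth_prime _)).2 fun e => ?_
        exact hij (Subtype.ext (Fin.ext (Nat.nth_injective Nat.infinite_setOfPred_prime e)))) hN
    refine h.trans ?_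
    rw [prod_coe_sort u fun j : Fin d =>
      ((Nat.nth Nat.Prime (j : ℕ) * Nat.clog (Nat.nth Nat.Prime (j : ℕ)) N : ℕ) : ℝ)]
    gcongr with j hj
    exact nth_prime_mul_clog_le (hu j hj)
  · push Not at hu
    obtain ⟨j, hj, hjN⟩ := hu
    have hlog : Real.log 2 ≤ Real.log N := Real.log_le_log (by norm_num) (by exact_mod_cast hN)
    have hone : ∀ i : Fin d, 1 ≤ 20 * (((i : ℕ) + 1) * Real.log N) := fun i => by
      have : (0 : ℝ) ≤ (i : ℕ) := by positivity
      nlinarith [Real.log_two_gt_d9]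
    have h1 : 20 * (((j : ℕ) + 1) * Real.log N) ≤ ∏ j ∈ u, 20 * (((j : ℕ) + 1) * Real.log N) := by
      classical
      rw [← mul_prod_erase u _ hj]
      exact le_mul_of_one_le_right (zero_le_one.trans (hone j)) (one_le_prod fun i _ => hone i)
    have h2 : N * haltonProjStarDisc d N u ≤ N :=
      mul_le_of_le_one_right (by positivity) (starDisc_le_one _ _)
    have h3 := natCast_le_of_lt_nth_prime hN hjN
    linarith [hone j]

theorem prod_one_add_mul_le_exp {x : ℕ → ℝ} (hx : ∀ i, 0 ≤ x i) (hs : Summable x) {δ : ℝ}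
    (hδ : 0 < δ) :
    ∃ C : ℝ, 0 < C ∧ ∀ (d : ℕ) (t : ℝ), 0 ≤ t →
      ∏ i ∈ range d, (1 + t * x i) ≤ C * Real.exp (δ * t) := by
  obtain ⟨J, hJ⟩ := ((tendsto_sum_nat_add x).eventually
    (gt_mem_nhds (half_pos hδ))).exists
  set η : ℝ := δ / (2 * (J + 1)) with hη
  have hη0 : 0 < η := by positivity
  refine ⟨∏ i ∈ range J, (1 + x i / η), prod_pos fun i _ => ?_, fun d t ht => ?_⟩
  · have := hx i
    positivity
  have hnn : ∀ i, 0 ≤ t * x i := fun i => mul_nonneg ht (hx i)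
  have h1 : ∏ i ∈ range d, (1 + t * x i) ≤ ∏ i ∈ range (J + d), (1 + t * x i) :=
    prod_le_prod_of_subset_of_one_le (by simp) (fun i _ => by linarith [hnn i])
      fun i _ _ => by linarith [hnn i]
  have h2 : ∏ i ∈ range J, (1 + t * x i)
      ≤ (∏ i ∈ range J, (1 + x i / η)) * Real.exp (δ / 2 * t) := by
    have : ∏ i ∈ range J, (1 + t * x i) ≤ ∏ i ∈ range J, ((1 + x i / η) * Real.exp (η * t)) := by
      refine prod_le_prod (fun i _ => by linarith [hnn i]) fun i _ => ?_
      have e1 := Real.add_one_le_exp (η * t)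
      have e2 : 0 ≤ x i / η := div_nonneg (hx i) hη0.le
      have e3 : x i / η * (η * t) = t * x i := by field_simp
      have e4 := mul_le_mul_of_nonneg_left e1 (by linarith : 0 ≤ 1 + x i / η)
      nlinarith [mul_nonneg hη0.le ht]
    refine this.trans ?_
    rw [prod_mul_distrib, prod_const, card_range, ← Real.exp_nat_mul]
    have hJη : J * η ≤ δ / 2 := by
      rw [hη, mul_div_assoc', div_le_div_iff₀ (by positivity) (by norm_num)]
      nlinarith
    refine mul_le_mul_of_nonneg_left (Real.exp_le_exp.2 ?_) (prod_nonneg fun i _ => ?_)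
    · rw [← mul_assoc]
      gcongr
    · have := hx i
      positivity
  have h3 : ∏ i ∈ range d, (1 + t * x (J + i)) ≤ Real.exp (δ / 2 * t) := by
    have e1 : ∏ i ∈ range d, (1 + t * x (J + i)) ≤ ∏ i ∈ range d, Real.exp (t * x (J + i)) :=
      prod_le_prod (fun i _ => by linarith [hnn (J + i)])
        fun i _ => by linarith [Real.add_one_le_exp (t * x (J + i))]
    refine e1.trans ?_
    rw [← Real.exp_sum, ← mul_sum, mul_comm]
    refine Real.exp_le_exp.2 (mul_le_mul_of_nonneg_right (le_trans ?_ hJ.le) ht)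
    simp only [add_comm J]
    exact ((summable_nat_add_iff J).2 hs).sum_le_tsum _ fun i _ => hx _
  have hexp : Real.exp (δ * t) = Real.exp (δ / 2 * t) * Real.exp (δ / 2 * t) := by
    rw [← Real.exp_add]
    ring_nf
  rw [hexp, ← mul_assoc]
  refine h1.trans ?_
  rw [prod_range_add]
  exact mul_le_mul h2 h3 (prod_nonneg fun i _ => by linarith [hnn (J + i)])
    ((prod_nonneg fun i _ => by linarith [hnn i]).trans h2)

/-- The weighted discrepancy of the first `N` Halton points is `O(N ^ (δ - 1))`, uniformly in the
dimension. -/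
theorem exists_mul_wHaltonStarDisc_le (γ : ℕ → ℝ) (hpos : ∀ j : ℕ, 1 ≤ j → 0 < γ j)
    (hsum : Summable fun j : ℕ => (j : ℝ) * γ j) {δ : ℝ} (hδ : 0 < δ) :
    ∃ C : ℝ, 0 < C ∧ ∀ d N : ℕ, 2 ≤ N → wHaltonStarDisc γ d N ≤ C * (N : ℝ) ^ (δ - 1) := by
  have hx : ∀ i : ℕ, 0 ≤ 20 * ((i + 1 : ℝ) * γ (i + 1)) := fun i => by
    have := hpos (i + 1) (by omega)
    positivity
  have hs : Summable fun i : ℕ => 20 * ((i + 1 : ℝ) * γ (i + 1)) := by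
    have := (summable_nat_add_iff 1).2 hsum
    push_cast at this
    exact this.mul_left 20
  obtain ⟨C, hC, h⟩ := prod_one_add_mul_le_exp hx hs hδ
  refine ⟨2 * C, by positivity, fun d N hN => ?_⟩
  have hN0 : (0 : ℝ) < N := by positivity
  have hlog : 0 ≤ Real.log N := Real.log_natCast_nonneg N
  refine Real.sSup_le ?_ (by positivity)
  rintro _ ⟨u, -, rfl⟩
  have hγ : 0 ≤ ∏ j ∈ u, γ (j.1 + 1) := prod_nonneg fun j _ => (hpos _ (by omega)).le
  have h1 := mul_le_mul_of_nonneg_left (mul_haltonProjStarDisc_le d hN u) hγ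
  have h2 : (∏ j ∈ u, γ (j.1 + 1)) * ∏ j ∈ u, 20 * (((j : ℕ) + 1) * Real.log N)
      ≤ C * (N : ℝ) ^ δ := by
    rw [← prod_mul_distrib]
    calc ∏ j ∈ u, γ (j.1 + 1) * (20 * (((j : ℕ) + 1) * Real.log N))
        ≤ ∏ j ∈ u, (1 + Real.log N * (20 * (((j : ℕ) + 1 : ℝ) * γ (j + 1)))) := by
          refine prod_le_prod (fun j _ => ?_) fun j _ => ?_
          · have := hpos (j + 1) (by omega)
            positivity
          · refine le_trans (le_of_eq ?_) (le_add_of_nonneg_left zero_le_one)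
            ring
      _ ≤ ∏ j : Fin d, (1 + Real.log N * (20 * (((j : ℕ) + 1 : ℝ) * γ (j + 1)))) :=
          prod_le_prod_of_subset_of_one_le (subset_univ u)
            (fun j _ => by linarith [mul_nonneg hlog (hx j)])
            fun j _ _ => by linarith [mul_nonneg hlog (hx j)]
      _ = ∏ i ∈ range d, (1 + Real.log N * (20 * ((i + 1 : ℝ) * γ (i + 1)))) :=
          Fin.prod_univ_eq_prod_range
            (fun i => 1 + Real.log N * (20 * ((i + 1 : ℝ) * γ (i + 1)))) d
      _ ≤ C * Real.exp (δ * Real.log N) := h d _ hlog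
      _ = C * (N : ℝ) ^ δ := by rw [Real.rpow_def_of_pos hN0, mul_comm δ]
  rw [Real.rpow_sub_one hN0.ne', mul_div_assoc', le_div_iff₀ hN0]
  linarith

/-- The weighted star discrepancy of the Halton sequence achieves strong polynomial
tractability with ε-exponent 1 whenever `∑_{j≥1} j·γ_j < ∞`. -/
theorem halton_weighted_star_disc_SPT_exponent_one
    (γ : ℕ → ℝ) (hpos : ∀ j : ℕ, 1 ≤ j → 0 < γ j)
    (hmono : ∀ j : ℕ, 1 ≤ j → γ (j + 1) ≤ γ j)
    (hsum : Summable fun j : ℕ => (j : ℝ) * γ j) :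
    ∀ β : ℝ, 1 < β → ∃ C : ℝ, 0 < C ∧
      ∀ d : ℕ, 1 ≤ d → ∀ ε : ℝ, 0 < ε → ε < 1 →
        ∃ N : ℕ, 1 ≤ N ∧ (N : ℝ) ≤ C * ε ^ (-β) ∧ wHaltonStarDisc γ d N ≤ ε := by
  intro β hβ
  have hβ0 : 0 < β := by linarith
  obtain ⟨C, hC, h⟩ := exists_mul_wHaltonStarDisc_le γ hpos hsum
    (sub_pos.2 (inv_lt_one_of_one_lt₀ hβ))
  set A : ℝ := C + 2 with hA
  have hA0 : 0 < A := by positivity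
  refine ⟨2 * A ^ β, by positivity, fun d _ ε hε hε1 => ?_⟩
  have hAε : 2 ≤ A / ε := by
    rw [le_div_iff₀ hε]
    nlinarith
  have hX : 2 ≤ (A / ε) ^ β :=
    hAε.trans (Real.self_le_rpow_of_one_le (by linarith) hβ.le)
  have hceil := Nat.le_ceil ((A / ε) ^ β)
  have hN2 : 2 ≤ ⌈(A / ε) ^ β⌉₊ := by exact_mod_cast hX.trans hceil
  refine ⟨⌈(A / ε) ^ β⌉₊, by omega, ?_, (h d _ hN2).trans ?_⟩
  · have h1 := Nat.ceil_lt_add_one (zero_le_two.trans hX)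
    have h2 : (A / ε) ^ β = A ^ β * ε ^ (-β) := by
      rw [Real.div_rpow hA0.le hε.le, Real.rpow_neg hε.le, div_eq_mul_inv]
    rw [mul_assoc, ← h2]
    linarith
  · have h1 : (⌈(A / ε) ^ β⌉₊ : ℝ) ^ (1 - β⁻¹ - 1) ≤ ((A / ε) ^ β) ^ (1 - β⁻¹ - 1) :=
      Real.rpow_le_rpow_of_nonpos (by linarith) hceil (by linarith [inv_pos.2 hβ0])
    have h2 : ((A / ε) ^ β) ^ (1 - β⁻¹ - 1) = ε / A := by
      rw [← Real.rpow_mul (by positivity), show β * (1 - β⁻¹ - 1) = -1 by field_simp; ring,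
        Real.rpow_neg_one, inv_div]
    rw [h2] at h1
    refine (mul_le_mul_of_nonneg_left h1 hC.le).trans ?_
    rw [mul_div_assoc', div_le_iff₀ hA0]
    nlinarith
end
end

section
/- Let γ_1 ≥ γ_2 ≥ ⋯ be a nonincreasing sequence of positive reals defining product weights γ_u = ∏_{j∈u} γ_j. Then for every dimension d ≥ 1 and every integer N ≥ 2, the weighted star discrepancy of the first N points of the d-dimensional Halton sequence satisfies D*_{N,γ}(H_{d,N}) ≤ (1/N)·( −1 + ∏_{j=1}^{d} (1 + 6·j·γ_j·log N) ). -/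
open Finset Real

noncomputable section

/-- The integer whose base-`p` digits are the lowest `m` digits of `n` in reverse order. -/
def digitRev (p : ℕ) : ℕ → ℕ → ℕ
  | 0, _ => 0
  | m + 1, n => p * digitRev p m n + n / p ^ m % p

lemma digitRev_lt {p : ℕ} (hp : 0 < p) (m n : ℕ) : digitRev p m n < p ^ m := by
  induction m with
  | zero => simp [digitRev]
  | succ m ih =>
    rw [digitRev, pow_succ]
    have h := Nat.mod_lt (n / p ^ m) hp
    nlinarith

lemma digitRev_succ_div {p : ℕ} (hp : 0 < p) (m n : ℕ) :
    digitRev p (m + 1) n / p = digitRev p m n := by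
  rw [digitRev, Nat.mul_add_div hp, Nat.div_eq_of_lt (Nat.mod_lt _ hp), add_zero]

lemma digitRev_succ_mod (p m n : ℕ) : digitRev p (m + 1) n % p = n / p ^ m % p := by
  simp [digitRev]

lemma digitRev_div_pow {p : ℕ} (hp : 0 < p) (m n : ℕ) :
    (digitRev p m n : ℝ) / (p : ℝ) ^ m =
      ∑ i ∈ Finset.range m, ((n / p ^ i % p : ℕ) : ℝ) / (p : ℝ) ^ (i + 1) := by
  induction m with
  | zero => simp [digitRev]
  | succ m ih =>
    have hp' : (p : ℝ) ≠ 0 := by positivity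
    rw [Finset.sum_range_succ, ← ih, digitRev]
    push_cast
    field_simp
    ring

lemma radInv_eq_digitRev {p : ℕ} (hp : 0 < p) {m n : ℕ} (hn : n < p ^ m) :
    radInv p n = (digitRev p m n : ℝ) / (p : ℝ) ^ m := by
  rw [digitRev_div_pow hp, radInv]
  apply tsum_eq_sum
  intro i hi
  have hi' : m ≤ i := by simpa using hi
  rw [Nat.div_eq_of_lt (hn.trans_le (Nat.pow_le_pow_right hp hi'))]
  simp

lemma exists_digitRev_eq_iff_modEq {p : ℕ} (hp : 0 < p) (m : ℕ) {v : ℕ} (hv : v < p ^ m) :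
    ∃ a : ℕ, ∀ n : ℕ, digitRev p m n = v ↔ n ≡ a [MOD p ^ m] := by
  induction m generalizing v with
  | zero =>
    refine ⟨0, fun n => ?_⟩
    have : v = 0 := by simpa using hv
    simp [digitRev, this, Nat.modEq_one]
  | succ m ih =>
    obtain ⟨a, ha⟩ := ih (v := v / p) (by
      rw [Nat.div_lt_iff_lt_mul hp, ← pow_succ]; exact hv)
    have hpm : 0 < p ^ m := by positivity
    refine ⟨a % p ^ m + p ^ m * (v % p), fun n => ?_⟩
    have hsplit : digitRev p (m + 1) n = v ↔
        digitRev p m n = v / p ∧ n / p ^ m % p = v % p := by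
      rw [← digitRev_succ_div hp m n, ← digitRev_succ_mod p m n]
      constructor
      · rintro rfl; exact ⟨rfl, rfl⟩
      · rintro ⟨h₁, h₂⟩
        rw [← Nat.div_add_mod (digitRev p (m + 1) n) p, h₁, h₂, Nat.div_add_mod]
    have hr₁ : (a % p ^ m + p ^ m * (v % p)) % p ^ m = a % p ^ m := by simp
    have hr₂ : (a % p ^ m + p ^ m * (v % p)) / p ^ m % p = v % p := by
      rw [Nat.add_mul_div_left _ _ hpm, Nat.div_eq_of_lt (Nat.mod_lt _ hpm)]
      simp
    rw [hsplit, ha, Nat.ModEq, Nat.ModEq, Nat.mod_pow_succ, Nat.mod_pow_succ, hr₁, hr₂]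
    constructor
    · rintro ⟨h₁, h₂⟩
      rw [h₁, h₂]
    · intro h
      have h₁ : n % p ^ m = a % p ^ m := by
        have := congrArg (· % p ^ m) h
        simpa using this
      refine ⟨h₁, ?_⟩
      rw [h₁] at h
      exact Nat.eq_of_mul_eq_mul_left hpm (Nat.add_left_cancel h)

lemma exists_elementary_decomposition_of_lt {p : ℕ} (hp : 0 < p) (m : ℕ) {c : ℕ}
    (hc : c < p ^ m) :
    ∃ T : Finset (ℕ × ℕ), T.card ≤ (p - 1) * m ∧
      (∀ x ∈ T, x.1 ≤ m ∧ x.2 < p ^ x.1) ∧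
      (∑ x ∈ T, 1 / (p : ℝ) ^ x.1 = (c : ℝ) / (p : ℝ) ^ m) ∧
      ∀ n : ℕ, (if digitRev p m n < c then (1 : ℝ) else 0) =
        ∑ x ∈ T, if digitRev p x.1 n = x.2 then (1 : ℝ) else 0 := by
  induction m generalizing c with
  | zero =>
    have : c = 0 := by simpa using hc
    exact ⟨∅, by simp, by simp, by simp [this], by simp [this]⟩
  | succ m ih =>
    obtain ⟨T, hcard, hT, hvol, hind⟩ := ih (c := c / p) (by
      rw [Nat.div_lt_iff_lt_mul hp, ← pow_succ]; exact hc)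
    have hp' : (p : ℝ) ≠ 0 := by positivity
    have hmod := Nat.mod_lt c hp
    have hdm := Nat.div_add_mod c p
    have hdisj : Disjoint T ({m + 1} ×ˢ Finset.Ico (p * (c / p)) c) := by
      rw [Finset.disjoint_left]
      intro x hx hx'
      have h₁ := (hT x hx).1
      have h₂ := (Finset.mem_product.1 hx').1
      simp at h₂
      omega
    refine ⟨T ∪ {m + 1} ×ˢ Finset.Ico (p * (c / p)) c, ?_, ?_, ?_, ?_⟩
    · rw [Finset.card_union_of_disjoint hdisj, Finset.card_product, Finset.card_singleton,
        Nat.card_Ico, one_mul, mul_add, mul_one]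
      omega
    · intro x hx
      rcases Finset.mem_union.1 hx with hx | hx
      · exact ⟨(hT x hx).1.trans (Nat.le_succ m), (hT x hx).2⟩
      · rw [Finset.mem_product, Finset.mem_singleton, Finset.mem_Ico] at hx
        exact ⟨hx.1.le, by rw [hx.1]; omega⟩
    · rw [Finset.sum_union hdisj, hvol, Finset.sum_product, Finset.sum_singleton]
      dsimp only
      rw [Finset.sum_const, Nat.card_Ico, nsmul_eq_mul, Nat.cast_sub (by omega)]
      push_cast
      field_simp
      ring
    · intro n
      have hdiv : digitRev p (m + 1) n < p * (c / p) ↔ digitRev p m n < c / p := by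
        rw [← digitRev_succ_div hp m n, Nat.div_lt_iff_lt_mul hp, mul_comm]
      rw [Finset.sum_union hdisj, ← hind, Finset.sum_product, Finset.sum_singleton]
      dsimp only
      rw [Finset.sum_ite_eq]
      simp only [← hdiv, Finset.mem_Ico]
      split_ifs <;> first | omega | norm_num

lemma exists_elementary_decomposition {p : ℕ} (hp : 2 ≤ p) {m : ℕ} (hm : 1 ≤ m) {c : ℕ}
    (hc : c ≤ p ^ m) :
    ∃ T : Finset (ℕ × ℕ), T.card ≤ (p - 1) * m ∧
      (∀ x ∈ T, x.2 < p ^ x.1) ∧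
      (∑ x ∈ T, 1 / (p : ℝ) ^ x.1 = (c : ℝ) / (p : ℝ) ^ m) ∧
      ∀ n : ℕ, (if digitRev p m n < c then (1 : ℝ) else 0) =
        ∑ x ∈ T, if digitRev p x.1 n = x.2 then (1 : ℝ) else 0 := by
  rcases hc.lt_or_eq with hc | rfl
  · obtain ⟨T, h₁, h₂, h₃, h₄⟩ := exists_elementary_decomposition_of_lt (by omega) m hc
    exact ⟨T, h₁, fun x hx => (h₂ x hx).2, h₃, h₄⟩
  · have hp' : (p : ℝ) ≠ 0 := by positivity
    refine ⟨{(0, 0)}, ?_, by simp, ?_, fun n => ?_⟩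
    · have : 1 * 1 ≤ (p - 1) * m := Nat.mul_le_mul (by omega) hm
      simpa using this
    · push_cast
      simp [hp']
    · rw [if_pos (digitRev_lt (by omega) m n), Finset.sum_singleton]
      simp [digitRev]

lemma abs_count_modEq_sub_le {r : ℕ} (hr : 0 < r) (N v : ℕ) :
    |(∑ n ∈ Finset.range N, if n ≡ v [MOD r] then (1 : ℝ) else 0) - (N : ℝ) / r| ≤ 1 := by
  have hsum : (∑ n ∈ Finset.range N, if n ≡ v [MOD r] then (1 : ℝ) else 0) =
      (N.count (· ≡ v [MOD r]) : ℝ) := by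
    rw [Nat.count_eq_card_filter_range, Finset.sum_boole]
  have hr' : (0 : ℝ) < r := by exact_mod_cast hr
  have hN : (N : ℝ) / r = (N / r : ℕ) + ((N % r : ℕ) : ℝ) / r := by
    rw [eq_comm, ← sub_eq_zero]
    field_simp
    have : ((r * (N / r) + N % r : ℕ) : ℝ) = N := by rw [Nat.div_add_mod]
    push_cast at this
    linarith
  have h₀ : 0 ≤ ((N % r : ℕ) : ℝ) / r := by positivity
  have h₁ : ((N % r : ℕ) : ℝ) / r ≤ 1 := by
    rw [div_le_one hr']
    exact_mod_cast (Nat.mod_lt N hr).le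
  rw [hsum, Nat.count_modEq_card _ hr, hN, abs_le]
  push_cast
  split_ifs <;> constructor <;> linarith

lemma exists_modEq_prod_iff {ι : Type} [Fintype ι] (r a : ι → ℕ) (hr : ∀ i, r i ≠ 0)
    (hco : Pairwise fun i j => (r i).Coprime (r j)) :
    ∃ k : ℕ, ∀ n : ℕ, (∀ i, n ≡ a i [MOD r i]) ↔ n ≡ k [MOD ∏ i, r i] := by
  obtain ⟨k, hk⟩ := Nat.chineseRemainderOfFinset a r Finset.univ (fun i _ => hr i)
    (fun i _ j _ hij => hco hij)
  refine ⟨k, fun n => ⟨fun h => ?_, fun h i => ?_⟩⟩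
  · rw [Nat.modEq_iff_dvd]
    push_cast
    refine Finset.prod_dvd_of_coprime
      (fun i _ j _ hij => Nat.isCoprime_iff_coprime.2 (hco hij)) fun i _ => ?_
    exact Nat.modEq_iff_dvd.1 ((h i).trans (hk i (Finset.mem_univ i)).symm)
  · exact (h.of_dvd (Finset.dvd_prod_of_mem r (Finset.mem_univ i))).trans
      (hk i (Finset.mem_univ i))

open scoped Classical in
lemma abs_count_elementary_box_sub_le {ι : Type} [Fintype ι] (p : ι → ℕ) (hp : ∀ i, 0 < p i)
    (hco : Pairwise fun i j => (p i).Coprime (p j)) (x : ι → ℕ × ℕ)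
    (hx : ∀ i, (x i).2 < p i ^ (x i).1) (N : ℕ) :
    |(∑ n ∈ Finset.range N, ∏ i, if digitRev (p i) (x i).1 n = (x i).2 then (1 : ℝ) else 0) -
      N * ∏ i, 1 / (p i : ℝ) ^ (x i).1| ≤ 1 := by
  choose a ha using fun i => exists_digitRev_eq_iff_modEq (hp i) (x i).1 (hx i)
  obtain ⟨k, hk⟩ := exists_modEq_prod_iff (fun i => p i ^ (x i).1) a
    (fun i => (pow_pos (hp i) _).ne') (fun i j hij => (hco hij).pow _ _)
  have h := abs_count_modEq_sub_le
    (Finset.prod_pos fun i (_ : i ∈ Finset.univ) => pow_pos (hp i) (x i).1) N k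
  convert h using 3
  · refine Finset.sum_congr rfl fun n _ => ?_
    rw [Fintype.prod_boole]
    simp only [ha, hk]
  · push_cast
    simp [div_eq_mul_inv]

open scoped Classical in
lemma abs_count_digitRev_box_sub_le {ι : Type} [Fintype ι] (p m c : ι → ℕ)
    (hp : ∀ i, 2 ≤ p i) (hco : Pairwise fun i j => (p i).Coprime (p j))
    (hm : ∀ i, 1 ≤ m i) (hc : ∀ i, c i ≤ p i ^ m i) (N : ℕ) :
    |(∑ n ∈ Finset.range N, if ∀ i, digitRev (p i) (m i) n < c i then (1 : ℝ) else 0) -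
      N * ∏ i, (c i : ℝ) / (p i : ℝ) ^ m i| ≤ ∏ i, ((p i : ℝ) - 1) * m i := by
  choose T hcard hT hvol hind using
    fun i => exists_elementary_decomposition (hp i) (hm i) (hc i)
  have hcount : (∑ n ∈ Finset.range N,
      if ∀ i, digitRev (p i) (m i) n < c i then (1 : ℝ) else 0) =
      ∑ x ∈ Fintype.piFinset T, ∑ n ∈ Finset.range N,
        ∏ i, if digitRev (p i) (x i).1 n = (x i).2 then (1 : ℝ) else 0 := by
    rw [Finset.sum_comm]
    refine Finset.sum_congr rfl fun n _ => ?_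
    rw [← Finset.prod_univ_sum T
      fun i y => if digitRev (p i) y.1 n = y.2 then (1 : ℝ) else 0, ← Fintype.prod_boole]
    exact Finset.prod_congr rfl fun i _ => hind i n
  have hprod : ∏ i, (c i : ℝ) / (p i : ℝ) ^ m i =
      ∑ x ∈ Fintype.piFinset T, ∏ i, 1 / (p i : ℝ) ^ (x i).1 := by
    rw [← Finset.prod_univ_sum T fun i y => 1 / (p i : ℝ) ^ y.1]
    exact Finset.prod_congr rfl fun i _ => (hvol i).symm
  rw [hcount, hprod, Finset.mul_sum, ← Finset.sum_sub_distrib]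
  calc _ ≤ ∑ x ∈ Fintype.piFinset T, (1 : ℝ) := by
        refine (Finset.abs_sum_le_sum_abs _ _).trans (Finset.sum_le_sum fun x hx => ?_)
        rw [Fintype.mem_piFinset] at hx
        exact abs_count_elementary_box_sub_le p (fun i => by linarith [hp i]) hco x
          (fun i => hT i _ (hx i)) N
    _ = ∏ i, ((T i).card : ℝ) := by simp
    _ ≤ ∏ i, ((p i : ℝ) - 1) * m i := by
        refine Finset.prod_le_prod (fun i _ => by positivity) fun i _ => ?_
        have h : ((T i).card : ℝ) ≤ ((p i - 1 : ℕ) : ℝ) * m i := by exact_mod_cast hcard i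
        rwa [Nat.cast_sub (by linarith [hp i]), Nat.cast_one] at h

lemma abs_prod_sub_prod_le_sum {ι : Type} (s : Finset ι) (f g : ι → ℝ)
    (hf : ∀ i, 0 ≤ f i ∧ f i ≤ 1) (hg : ∀ i, 0 ≤ g i ∧ g i ≤ 1) :
    |∏ i ∈ s, f i - ∏ i ∈ s, g i| ≤ ∑ i ∈ s, |f i - g i| := by
  classical
  induction s using Finset.induction_on with
  | empty => simp
  | insert i s his ih =>
    rw [Finset.prod_insert his, Finset.prod_insert his, Finset.sum_insert his]
    have h₀ : 0 ≤ ∏ j ∈ s, f j := Finset.prod_nonneg fun j _ => (hf j).1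
    have h₁ : ∏ j ∈ s, f j ≤ 1 := Finset.prod_le_one (fun j _ => (hf j).1) fun j _ => (hf j).2
    calc |f i * ∏ j ∈ s, f j - g i * ∏ j ∈ s, g j|
        = |(f i - g i) * ∏ j ∈ s, f j + g i * (∏ j ∈ s, f j - ∏ j ∈ s, g j)| := by
          congr 1; ring
      _ ≤ |f i - g i| * ∏ j ∈ s, f j + g i * |∏ j ∈ s, f j - ∏ j ∈ s, g j| := by
          refine (abs_add_le _ _).trans (le_of_eq ?_)
          rw [abs_mul, abs_mul, abs_of_nonneg h₀, abs_of_nonneg (hg i).1]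
      _ ≤ |f i - g i| + |∏ j ∈ s, f j - ∏ j ∈ s, g j| :=
          add_le_add (mul_le_of_le_one_right (abs_nonneg _) h₁)
            (mul_le_of_le_one_left (abs_nonneg _) (hg i).2)
      _ ≤ _ := by gcongr

lemma prod_add_card_le_prod_add_one {ι : Type} (s : Finset ι) (a : ι → ℝ) (ha : ∀ i, 1 ≤ a i) :
    ∏ i ∈ s, a i + s.card ≤ ∏ i ∈ s, (a i + 1) := by
  classical
  induction s using Finset.induction_on with
  | empty => simp
  | insert i s his ih =>
    rw [Finset.prod_insert his, Finset.prod_insert his, Finset.card_insert_of_notMem his]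
    push_cast
    have h₁ : 1 ≤ ∏ j ∈ s, a j := Finset.one_le_prod fun j _ => ha j
    have hs : (0 : ℝ) ≤ s.card := by positivity
    nlinarith [ha i, mul_le_mul_of_nonneg_left ih (by linarith [ha i] : 0 ≤ a i + 1),
      mul_nonneg hs (by linarith [ha i] : 0 ≤ a i)]

open scoped Classical in
lemma sum_radInv_box_eq {ι : Type} [Fintype ι] (p m : ι → ℕ) (hp : ∀ i, 0 < p i) {N : ℕ}
    (hN : ∀ i, N ≤ p i ^ m i) (α : ι → ℝ) :
    (((Finset.univ.filter fun n : Fin N =>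
      ∀ i, 0 ≤ radInv (p i) n ∧ radInv (p i) n < α i).card : ℕ) : ℝ) =
    ∑ n ∈ Finset.range N,
      if ∀ i, digitRev (p i) (m i) n < ⌈α i * (p i : ℝ) ^ m i⌉₊ then (1 : ℝ) else 0 := by
  rw [← Finset.sum_boole, ← Fin.sum_univ_eq_sum_range
    (fun n => if ∀ i, digitRev (p i) (m i) n < ⌈α i * (p i : ℝ) ^ m i⌉₊ then (1 : ℝ) else 0)]
  refine Finset.sum_congr rfl fun n _ => ?_
  congr 1
  refine propext (forall_congr' fun i => ?_)
  have hpos : (0 : ℝ) < (p i : ℝ) ^ m i := pow_pos (by exact_mod_cast hp i) _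
  rw [radInv_eq_digitRev (hp i) (n.2.trans_le (hN i)), Nat.lt_ceil, div_lt_iff₀ hpos]
  exact and_iff_right (by positivity)

open scoped Classical in
/-- Halton's bound: `N` times the local discrepancy of a van der Corput-Halton point set in
coprime bases is at most `∏ ((pᵢ - 1) mᵢ + 1)` whenever `N ≤ pᵢ ^ mᵢ`. -/
lemma abs_radInv_local_discrepancy_le {ι : Type} [Fintype ι] (p m : ι → ℕ)
    (hp : ∀ i, 2 ≤ p i) (hco : Pairwise fun i j => (p i).Coprime (p j))
    (hm : ∀ i, 1 ≤ m i) {N : ℕ} (hN : ∀ i, N ≤ p i ^ m i) (α : ι → ℝ)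
    (hα : ∀ i, 0 ≤ α i ∧ α i ≤ 1) :
    |((Finset.univ.filter fun n : Fin N =>
      ∀ i, 0 ≤ radInv (p i) n ∧ radInv (p i) n < α i).card : ℝ) - N * ∏ i, α i| ≤
      ∏ i, (((p i : ℝ) - 1) * m i + 1) := by
  have hpos : ∀ i, (0 : ℝ) < (p i : ℝ) ^ m i := fun i =>
    pow_pos (by exact_mod_cast (by linarith [hp i] : 0 < p i)) _
  have hc : ∀ i, ⌈α i * (p i : ℝ) ^ m i⌉₊ ≤ p i ^ m i := fun i => by
    rw [Nat.ceil_le]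
    push_cast
    exact mul_le_of_le_one_left (hpos i).le (hα i).2
  have hcount := abs_count_digitRev_box_sub_le p m (fun i => ⌈α i * (p i : ℝ) ^ m i⌉₊)
    hp hco hm hc N
  have hvol := abs_prod_sub_prod_le_sum Finset.univ
    (fun i => (⌈α i * (p i : ℝ) ^ m i⌉₊ : ℝ) / (p i : ℝ) ^ m i) α
    (fun i => ⟨by positivity, by
      rw [div_le_one (hpos i)]
      exact_mod_cast hc i⟩) hα
  have hround : ∀ i, N * |(⌈α i * (p i : ℝ) ^ m i⌉₊ : ℝ) / (p i : ℝ) ^ m i - α i| ≤ 1 := by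
    intro i
    have hNi : (N : ℝ) ≤ (p i : ℝ) ^ m i := by exact_mod_cast hN i
    have hnn : 0 ≤ α i * (p i : ℝ) ^ m i := mul_nonneg (hα i).1 (hpos i).le
    rw [div_sub' (hpos i).ne', abs_div, abs_of_pos (hpos i), mul_comm _ (α i),
      abs_of_nonneg (sub_nonneg.2 (Nat.le_ceil _)), ← mul_div_assoc, div_le_one (hpos i)]
    have := Nat.ceil_lt_add_one hnn
    calc _ ≤ (N : ℝ) * 1 := by gcongr; linarith
      _ ≤ _ := by linarith
  have hsum : N * ∑ i, |(⌈α i * (p i : ℝ) ^ m i⌉₊ : ℝ) / (p i : ℝ) ^ m i - α i| ≤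
      (Finset.univ : Finset ι).card := by
    rw [Finset.mul_sum]
    exact (Finset.sum_le_sum fun i _ => hround i).trans (by simp)
  have hprod := prod_add_card_le_prod_add_one Finset.univ
    (fun i => ((p i : ℝ) - 1) * m i) fun i => by
      have h₁ : (2 : ℝ) ≤ p i := by exact_mod_cast hp i
      have h₂ : (1 : ℝ) ≤ m i := by exact_mod_cast hm i
      nlinarith
  rw [sum_radInv_box_eq p m (fun i => by linarith [hp i]) hN α]
  refine le_trans ?_ hprod
  refine (abs_sub_le _ (N * ∏ i, (⌈α i * (p i : ℝ) ^ m i⌉₊ : ℝ) / (p i : ℝ) ^ m i) _).trans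
    (add_le_add hcount ?_)
  rw [← mul_sub, abs_mul, Nat.abs_cast]
  exact (mul_le_mul_of_nonneg_left hvol (Nat.cast_nonneg N)).trans hsum

lemma le_three_mul_primeCounting_mul_log {n : ℕ} (hn : 2 ≤ n) :
    (n : ℝ) ≤ 3 * Nat.primeCounting n * Real.log n := by
  have hlog2 := Real.log_two_gt_d9
  rcases lt_or_ge n 6 with h | h
  · have hlog : Real.log 2 ≤ Real.log n :=
      Real.log_le_log (by norm_num) (by exact_mod_cast hn)
    have hlog4 : Real.log 4 = 2 * Real.log 2 := by
      rw [← Real.log_rpow (by norm_num)]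
      norm_num
    have hlog5 : Real.log 4 ≤ Real.log 5 := Real.log_le_log (by norm_num) (by norm_num)
    have hπ₂ : Nat.primeCounting 2 = 1 := by decide
    have hπ₃ : Nat.primeCounting 3 = 2 := by decide
    have hπ₄ : Nat.primeCounting 4 = 2 := by decide
    have hπ₅ : Nat.primeCounting 5 = 3 := by decide
    interval_cases n <;> simp only [hπ₂, hπ₃, hπ₄, hπ₅] <;> push_cast at * <;> linarith
  · have h₁ := Chebyshev.psi_le_primeCounting_mul_log n
    have h₂ := Chebyshev.psi_ge n
    have hn' : (6 : ℝ) ≤ n := by exact_mod_cast h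
    have h₃ : Real.log ((n : ℝ) + 1) ≤ 3 * Real.log 2 + ((n : ℝ) + 1) / 8 - 1 := by
      have := Real.log_le_sub_one_of_pos (by positivity : 0 < ((n : ℝ) + 1) / 8)
      rw [Real.log_div (by positivity) (by norm_num)] at this
      have h8 : Real.log 8 = 3 * Real.log 2 := by
        rw [← Real.log_rpow (by norm_num)]
        norm_num
      linarith
    nlinarith

lemma nth_prime_le_mul_log (j : ℕ) :
    (Nat.nth Nat.Prime j : ℝ) ≤ 3 * ((j + 1 : ℕ) : ℝ) * Real.log (Nat.nth Nat.Prime j) := by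
  have hπ : Nat.primeCounting (Nat.nth Nat.Prime j) = j + 1 := by
    rw [Nat.primeCounting, Nat.primeCounting', Nat.count_succ, if_pos (Nat.prime_nth_prime j)]
    exact congrArg (· + 1) (Nat.primeCounting'_nth_eq j)
  rw [← hπ]
  exact le_three_mul_primeCounting_mul_log (Nat.prime_nth_prime j).two_le

lemma le_mul_log_of_le_nth_prime {j N : ℕ} (hN : 2 ≤ N) (h : N ≤ Nat.nth Nat.Prime j) :
    (N : ℝ) ≤ 3 * ((j + 1 : ℕ) : ℝ) * Real.log N := by
  have hπ : Nat.primeCounting N ≤ j + 1 := by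
    calc Nat.primeCounting N ≤ Nat.primeCounting' N + 1 := by
          rw [Nat.primeCounting, Nat.primeCounting', Nat.count_succ]
          split_ifs <;> omega
      _ ≤ j + 1 := by
          have := Nat.monotone_primeCounting' h
          rw [Nat.primeCounting'_nth_eq] at this
          omega
  refine (le_three_mul_primeCounting_mul_log hN).trans ?_
  have hlog : 0 ≤ Real.log N := Real.log_natCast_nonneg N
  gcongr

lemma one_le_six_mul_log (j : ℕ) {N : ℕ} (hN : 2 ≤ N) :
    1 ≤ 6 * ((j + 1 : ℕ) : ℝ) * Real.log N := by
  have hlog : Real.log 2 ≤ Real.log N := Real.log_le_log (by norm_num) (by exact_mod_cast hN)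
  have hlog2 := Real.log_two_gt_d9
  push_cast
  have hj : (0 : ℝ) ≤ j := by positivity
  nlinarith [mul_nonneg hj (by linarith : 0 ≤ Real.log N)]

lemma sub_one_mul_clog_add_one_le {j N : ℕ} (h : Nat.nth Nat.Prime j < N) :
    ((Nat.nth Nat.Prime j : ℝ) - 1) * Nat.clog (Nat.nth Nat.Prime j) N + 1 ≤
      6 * ((j + 1 : ℕ) : ℝ) * Real.log N := by
  have hpj := nth_prime_le_mul_log j
  have hp2 := (Nat.prime_nth_prime j).two_le
  generalize Nat.nth Nat.Prime j = p at *
  have hp2' : (2 : ℝ) ≤ p := by exact_mod_cast hp2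
  have hlogp : 0 < Real.log p := Real.log_pos (by linarith)
  have hlog : Real.log p ≤ Real.log N :=
    Real.log_le_log (by positivity) (by exact_mod_cast h.le)
  have hclog : 1 ≤ Nat.clog p N := Nat.clog_pos hp2 (by omega)
  have hclog' : (1 : ℝ) ≤ Nat.clog p N := by exact_mod_cast hclog
  have hpow : ((Nat.clog p N : ℝ) - 1) * Real.log p ≤ Real.log N := by
    have h₁ : p ^ (Nat.clog p N - 1) < N := Nat.pow_pred_clog_lt_self hp2 (by omega)
    have h₂ : Real.log ((p : ℝ) ^ (Nat.clog p N - 1)) ≤ Real.log N :=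
      Real.log_le_log (by positivity) (by exact_mod_cast h₁.le)
    rwa [Real.log_pow, Nat.cast_sub hclog, Nat.cast_one] at h₂
  have hlogs : Nat.clog p N * Real.log p ≤ 2 * Real.log N := by linarith
  calc ((p : ℝ) - 1) * Nat.clog p N + 1 ≤ p * Nat.clog p N := by linarith
    _ ≤ 3 * ((j + 1 : ℕ) : ℝ) * Real.log p * Nat.clog p N := by gcongr
    _ = 3 * ((j + 1 : ℕ) : ℝ) * (Nat.clog p N * Real.log p) := by ring
    _ ≤ 3 * ((j + 1 : ℕ) : ℝ) * (2 * Real.log N) := by gcongr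
    _ = _ := by ring

open scoped Classical in
lemma abs_halton_local_discrepancy_le {d N : ℕ} (hN : 2 ≤ N) {u : Finset (Fin d)}
    (α : u → ℝ) (hα : ∀ i, 0 ≤ α i ∧ α i ≤ 1) :
    |((Finset.univ.filter fun n : Fin N =>
      ∀ i : u, 0 ≤ halton d n i.1 ∧ halton d n i.1 < α i).card : ℝ) - N * ∏ i, α i| ≤
      ∏ j ∈ u, 6 * ((j.1 + 1 : ℕ) : ℝ) * Real.log N := by
  have hprime : ∀ i : u, (Nat.nth Nat.Prime i.1).Prime := fun i => Nat.prime_nth_prime _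
  by_cases hbig : ∃ i : u, N ≤ Nat.nth Nat.Prime i.1
  · obtain ⟨i, hi⟩ := hbig
    have hcard : ((Finset.univ.filter fun n : Fin N =>
        ∀ i : u, 0 ≤ halton d n i.1 ∧ halton d n i.1 < α i).card : ℝ) ≤ N := by
      exact_mod_cast (Finset.card_le_univ _).trans (Fintype.card_fin N).le
    have hprod₀ : 0 ≤ ∏ i, α i := Finset.prod_nonneg fun i _ => (hα i).1
    have hprod₁ : ∏ i, α i ≤ 1 := Finset.prod_le_one (fun i _ => (hα i).1) fun i _ => (hα i).2
    have hNR : (0 : ℝ) ≤ N := Nat.cast_nonneg N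
    have htrivial : |((Finset.univ.filter fun n : Fin N =>
        ∀ i : u, 0 ≤ halton d n i.1 ∧ halton d n i.1 < α i).card : ℝ) - N * ∏ i, α i| ≤ N := by
      rw [abs_le]
      constructor
      · have := mul_le_of_le_one_right hNR hprod₁
        have : (0 : ℝ) ≤ ((Finset.univ.filter fun n : Fin N =>
          ∀ i : u, 0 ≤ halton d n i.1 ∧ halton d n i.1 < α i).card : ℝ) := Nat.cast_nonneg _
        linarith
      · have := mul_nonneg hNR hprod₀
        linarith
    have hlog : 0 ≤ Real.log N := Real.log_natCast_nonneg N
    refine htrivial.trans ?_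
    rw [← Finset.mul_prod_erase u _ i.2]
    calc (N : ℝ) ≤ 3 * ((i.1.1 + 1 : ℕ) : ℝ) * Real.log N := le_mul_log_of_le_nth_prime hN hi
      _ ≤ 6 * ((i.1.1 + 1 : ℕ) : ℝ) * Real.log N := by gcongr; norm_num
      _ ≤ _ := le_mul_of_one_le_right (by positivity)
          (Finset.one_le_prod fun j _ => one_le_six_mul_log j.1 hN)
  · push Not at hbig
    have hbound := abs_radInv_local_discrepancy_le (fun i : u => Nat.nth Nat.Prime i.1)
      (fun i => Nat.clog (Nat.nth Nat.Prime i.1) N) (fun i => (hprime i).two_le)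
      (fun i j hij => (Nat.coprime_primes (hprime i) (hprime j)).2 fun h =>
        hij (Subtype.ext (Fin.ext
          (Nat.nth_injective Nat.infinite_setOfPred_prime h))))
      (fun i => Nat.clog_pos (hprime i).one_lt hN)
      (fun i => Nat.le_pow_clog (hprime i).one_lt N) α hα
    refine hbound.trans ?_
    rw [← Finset.prod_coe_sort u fun j => 6 * ((j.1 + 1 : ℕ) : ℝ) * Real.log N]
    refine Finset.prod_le_prod (fun i _ => ?_) fun i _ => sub_one_mul_clog_add_one_le (hbig i)
    have : (1 : ℝ) ≤ Nat.nth Nat.Prime i.1 := by exact_mod_cast (hprime i).one_lt.le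
    have := mul_nonneg (sub_nonneg.2 this)
      (Nat.cast_nonneg (α := ℝ) (Nat.clog (Nat.nth Nat.Prime i.1) N))
    linarith

lemma haltonProjStarDisc_le {d N : ℕ} (hN : 2 ≤ N) (u : Finset (Fin d)) :
    haltonProjStarDisc d N u ≤ (1 / N) * ∏ j ∈ u, 6 * ((j.1 + 1 : ℕ) : ℝ) * Real.log N := by
  have hlog : 0 ≤ Real.log N := Real.log_natCast_nonneg N
  have hNpos : (0 : ℝ) < N := by exact_mod_cast (by omega : 0 < N)
  refine Real.sSup_le ?_ (mul_nonneg (by positivity) (Finset.prod_nonneg fun j _ => by positivity))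
  rintro t ⟨α, hα, rfl⟩
  have h := abs_halton_local_discrepancy_le hN α hα
  rw [div_sub' hNpos.ne', abs_div, abs_of_pos hNpos, one_div_mul_eq_div]
  gcongr

/-- `D*_{N,γ}(H_{d,N}) ≤ (1/N)·(−1 + ∏_{j=1}^d (1 + 6·j·γ_j·log N))`. -/
theorem halton_weighted_star_disc_product_bound
    (γ : ℕ → ℝ) (hpos : ∀ j : ℕ, 1 ≤ j → 0 < γ j)
    (hmono : ∀ j : ℕ, 1 ≤ j → γ (j + 1) ≤ γ j) :
    ∀ d : ℕ, 1 ≤ d → ∀ N : ℕ, 2 ≤ N →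
      wHaltonStarDisc γ d N ≤
        (1 / N) * (-1 + ∏ j ∈ Finset.range d,
          (1 + 6 * ((j + 1 : ℕ) : ℝ) * γ (j + 1) * Real.log N)) := by
  intro d _ N hN
  have hlog : 0 ≤ Real.log N := Real.log_natCast_nonneg N
  have hfac : ∀ j : ℕ, 0 ≤ 6 * ((j + 1 : ℕ) : ℝ) * γ (j + 1) * Real.log N := fun j => by
    have := hpos (j + 1) (by omega)
    positivity
  have hprod : ∏ j ∈ Finset.range d, (1 + 6 * ((j + 1 : ℕ) : ℝ) * γ (j + 1) * Real.log N) =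
      ∑ u : Finset (Fin d), ∏ j ∈ u, 6 * ((j.1 + 1 : ℕ) : ℝ) * γ (j.1 + 1) * Real.log N := by
    rw [Finset.prod_range, Finset.prod_one_add, Finset.powerset_univ]
  have hone : 1 ≤ ∏ j ∈ Finset.range d,
      (1 + 6 * ((j + 1 : ℕ) : ℝ) * γ (j + 1) * Real.log N) :=
    Finset.one_le_prod fun j _ => by linarith [hfac j]
  refine Real.sSup_le ?_ (mul_nonneg (by positivity) (by linarith))
  rintro t ⟨u, hu, rfl⟩
  have hγ : 0 ≤ ∏ j ∈ u, γ (j.1 + 1) :=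
    Finset.prod_nonneg fun j _ => (hpos _ (by omega)).le
  have hpair : (1 : ℝ) + ∏ j ∈ u, 6 * ((j.1 + 1 : ℕ) : ℝ) * γ (j.1 + 1) * Real.log N ≤
      ∏ j ∈ Finset.range d, (1 + 6 * ((j + 1 : ℕ) : ℝ) * γ (j + 1) * Real.log N) := by
    rw [hprod]
    have h := Finset.sum_le_sum_of_subset_of_nonneg
      (f := fun u : Finset (Fin d) =>
        ∏ j ∈ u, 6 * ((j.1 + 1 : ℕ) : ℝ) * γ (j.1 + 1) * Real.log N)
      (Finset.subset_univ {∅, u}) fun v _ _ => Finset.prod_nonneg fun j _ => hfac j.1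
    rwa [Finset.sum_pair hu.ne_empty.symm, Finset.prod_empty] at h
  calc (∏ j ∈ u, γ (j.1 + 1)) * haltonProjStarDisc d N u
      ≤ (∏ j ∈ u, γ (j.1 + 1)) *
          ((1 / N) * ∏ j ∈ u, 6 * ((j.1 + 1 : ℕ) : ℝ) * Real.log N) :=
        mul_le_mul_of_nonneg_left (haltonProjStarDisc_le hN u) hγ
    _ = (1 / N) * ∏ j ∈ u, 6 * ((j.1 + 1 : ℕ) : ℝ) * γ (j.1 + 1) * Real.log N := by
        rw [mul_left_comm, ← Finset.prod_mul_distrib]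
        congr 1
        exact Finset.prod_congr rfl fun j _ => by ring
    _ ≤ _ := by
        gcongr
        linarith
end
end

section
/- Let (γ_j)_{j≥1} be a sequence of positive reals with ∑_{j≥1} j·γ_j < ∞. Then for every δ > 0 there exists a constant c_δ > 0 such that for all integers d ≥ 1 and N ≥ 2, ∏_{j=1}^{d} (1 + 6·j·γ_j·log N) ≤ c_δ · N^{δ}. -/
/-- For a nonnegative summable sequence `a`, the products `∏ j < d, (1 + a j * x)` grow
subexponentially in `x ≥ 0`, uniformly in `d`. -/
theorem exists_prod_one_add_mul_le_exp {a : ℕ → ℝ} (ha : ∀ j, 0 ≤ a j) (hs : Summable a)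
    {δ : ℝ} (hδ : 0 < δ) :
    ∃ c : ℝ, 0 < c ∧ ∀ d : ℕ, ∀ x : ℝ, 0 ≤ x →
      ∏ j ∈ Finset.range d, (1 + a j * x) ≤ c * Real.exp (δ * x) := by
  obtain ⟨M, hM⟩ := ((tendsto_sum_nat_add a).eventually_lt_const (half_pos hδ)).exists
  set η : ℝ := δ / (2 * (M + 1)) with hη
  have hη0 : 0 < η := by positivity
  have hMη : M * η ≤ δ / 2 := by
    rw [hη, ← mul_div_assoc, div_le_div_iff₀ (by positivity) two_pos]
    nlinarith
  refine ⟨∏ j ∈ Finset.range M, (1 + a j / η),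
    Finset.prod_pos fun j _ => by have := ha j; positivity, fun d x hx => ?_⟩
  have hnn : ∀ j, 0 ≤ a j * x := fun j => mul_nonneg (ha j) hx
  have head : ∏ j ∈ Finset.range M, (1 + a j * x) ≤
      (∏ j ∈ Finset.range M, (1 + a j / η)) * Real.exp (M * (η * x)) := by
    rw [Real.exp_nat_mul, ← Finset.card_range M, ← Finset.prod_const, Finset.card_range,
      ← Finset.prod_mul_distrib]
    refine Finset.prod_le_prod (fun j _ => by linarith [hnn j]) fun j _ => ?_
    have h1 : 0 ≤ a j / η := div_nonneg (ha j) hη0.le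
    calc 1 + a j * x ≤ (1 + a j / η) * (η * x + 1) := by
          have h2 : a j / η * (η * x) = a j * x := by field_simp
          nlinarith [mul_nonneg hη0.le hx]
      _ ≤ _ := by gcongr; exact Real.add_one_le_exp _
  have tail : ∏ j ∈ Finset.range d, (1 + a (M + j) * x) ≤ Real.exp (δ / 2 * x) := by
    calc _ ≤ ∏ j ∈ Finset.range d, Real.exp (a (M + j) * x) :=
          Finset.prod_le_prod (fun j _ => by linarith [hnn (M + j)]) fun j _ => by
            linarith [Real.add_one_le_exp (a (M + j) * x)]
      _ = Real.exp ((∑ j ∈ Finset.range d, a (j + M)) * x) := by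
          rw [← Real.exp_sum, Finset.sum_mul]
          simp only [add_comm]
      _ ≤ _ := by
          gcongr
          exact (((summable_nat_add_iff M).2 hs).sum_le_tsum _ fun j _ => ha _).trans hM.le
  have hC : 0 ≤ ∏ j ∈ Finset.range M, (1 + a j / η) :=
    Finset.prod_nonneg fun j _ => by have := ha j; positivity
  calc ∏ j ∈ Finset.range d, (1 + a j * x)
      ≤ ∏ j ∈ Finset.range (M + d), (1 + a j * x) :=
        Finset.prod_le_prod_of_subset_of_one_le
          (Finset.range_subset_range.2 (Nat.le_add_left d M))
          (fun j _ => by linarith [hnn j]) fun j _ _ => by linarith [hnn j]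
    _ = (∏ j ∈ Finset.range M, (1 + a j * x)) *
          ∏ j ∈ Finset.range d, (1 + a (M + j) * x) := Finset.prod_range_add _ _ _
    _ ≤ (∏ j ∈ Finset.range M, (1 + a j / η)) * Real.exp (M * (η * x)) *
          Real.exp (δ / 2 * x) :=
        mul_le_mul head tail (Finset.prod_nonneg fun j _ => by linarith [hnn (M + j)])
          (by positivity)
    _ ≤ _ := by
        rw [mul_assoc, ← Real.exp_add]
        gcongr
        nlinarith [mul_le_mul_of_nonneg_right hMη hx]

/-- If `∑_{j≥1} j·γ_j < ∞` then for every `δ > 0` there is `c_δ > 0` with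
`∏_{j=1}^d (1 + 6·j·γ_j·log N) ≤ c_δ · N^δ` for all `d ≥ 1`, `N ≥ 2`. -/
theorem product_one_add_le_rpow
    (γ : ℕ → ℝ) (hpos : ∀ j : ℕ, 1 ≤ j → 0 < γ j)
    (hsum : Summable fun j : ℕ => (j : ℝ) * γ j) :
    ∀ δ : ℝ, 0 < δ → ∃ c : ℝ, 0 < c ∧
      ∀ d : ℕ, 1 ≤ d → ∀ N : ℕ, 2 ≤ N →
        (∏ j ∈ Finset.range d, (1 + 6 * ((j + 1 : ℕ) : ℝ) * γ (j + 1) * Real.log N)) ≤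
          c * (N : ℝ) ^ δ := by
  intro δ hδ
  have hs : Summable fun j : ℕ => 6 * ((j + 1 : ℕ) : ℝ) * γ (j + 1) := by
    simpa only [mul_assoc] using ((summable_nat_add_iff 1).2 hsum).mul_left 6
  obtain ⟨c, hc, h⟩ := exists_prod_one_add_mul_le_exp
    (fun j => by have := hpos (j + 1) (Nat.le_add_left 1 j); positivity) hs hδ
  refine ⟨c, hc, fun d _ N hN => ?_⟩
  rw [Real.rpow_def_of_pos (by positivity), mul_comm (Real.log N) δ]
  exact h d _ (Real.log_natCast_nonneg N)
end
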